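/- Let $n\geq 2$, $\gamma\in(0,1)$, and $\bar\alpha,\alpha\in\mathbb{R}$ with $\bar\alpha<0$, $-\bar\alpha-\alpha<2\gamma$ and $n>\alpha$. Define $\kappa^{n,\bar\alpha}_{\alpha,\gamma}=\mathrm{P.V.}\int_{\mathbb{R}^n}\frac{1-|\zeta|^{-\bar\alpha}}{|e_1-\zeta|^{n+2\gamma}|\zeta|^{\alpha}}\,d\zeta$. Then $\kappa^{n,\bar\alpha}_{\alpha,\gamma}>0$ if $\alpha>\frac{n-2\gamma}{2}-\frac{\bar\alpha}{2}$, $\kappa^{n,\bar\alpha}_{\alpha,\gamma}<0$ if $\alpha<\frac{n-2\gamma}{2}-\frac{\bar\alpha}{2}$, and $\kappa^{n,\bar\alpha}_{\alpha,\gamma}=0$ if $\alpha=\frac{n-2\gamma}{2}-\frac{\bar\alpha}{2}$. -/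

import Mathlib

open Filter Topology MeasureTheory

noncomputable def FF {n : ℕ} (e : EuclideanSpace ℝ (Fin n)) (s p a : ℝ)
    (x : EuclideanSpace ℝ (Fin n)) : ℝ := (1 - ‖x‖ ^ s) / (‖e - x‖ ^ p * ‖x‖ ^ a)

lemma norm_int {n : ℕ} (hn : 2 ≤ n) (b R : ℝ) (hR : 0 < R) (hb : -(n:ℝ) < b) :
    IntegrableOn (fun x : EuclideanSpace ℝ (Fin n) => ‖x‖ ^ b) (Metric.ball 0 R) := by
  have : Nonempty (Fin n) := ⟨⟨0, by omega⟩⟩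
  have : Nontrivial (EuclideanSpace ℝ (Fin n)) := inferInstance
  rw [integrableOn_fun_norm_addHaar volume (f := fun y : ℝ => y ^ b)]
  have : IntegrableOn (fun y : ℝ => y ^ ((n:ℝ) - 1 + b)) (Set.Ioo 0 R) := by
    rw [intervalIntegral.integrableOn_Ioo_rpow_iff hR]; linarith
  refine this.congr_fun (fun y hy => ?_) measurableSet_Ioo
  simp only [finrank_euclideanSpace, Fintype.card_fin, smul_eq_mul]
  rw [Real.rpow_add hy.1, ← Real.rpow_natCast, Nat.cast_sub (by omega)]; simp

lemma one_sub_le (s r : ℝ) (hs : 0 < s) (h0 : 0 ≤ r) (h1 : r ≤ 1) :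
    1 - r ^ s ≤ (1 + s) * (1 - r) := by
  rcases le_total 1 s with h | h
  · have := one_add_mul_self_le_rpow_one_add (s := r - 1) (by linarith) h
    rw [show 1 + (r-1) = r by ring] at this
    nlinarith
  · have : r ^ (1:ℝ) ≤ r ^ s := Real.rpow_le_rpow_of_exponent_ge' h0 h1 hs.le h
    rw [Real.rpow_one] at this
    nlinarith

lemma rpow_bd (t b : ℝ) (h1 : 1/2 ≤ t) (h2 : t ≤ 2) : t ^ b ≤ 2 ^ |b| := by
  rcases le_total 0 b with h | h
  · rw [abs_of_nonneg h]; exact Real.rpow_le_rpow (by linarith) h2 h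
  · rw [abs_of_nonpos h]
    have : (2:ℝ) ^ (-b) = (1/2) ^ b := by
      rw [Real.rpow_neg (by norm_num), one_div, Real.inv_rpow (by norm_num)]
    rw [this]
    exact Real.rpow_le_rpow_of_nonpos (by norm_num) h1 h

lemma FF_meas {n : ℕ} (e : EuclideanSpace ℝ (Fin n)) (s p a : ℝ) : Measurable (FF e s p a) := by
  unfold FF; fun_prop

lemma FF_nonneg {n : ℕ} (e : EuclideanSpace ℝ (Fin n)) (s p a : ℝ) (hs : 0 < s) 
    (x : EuclideanSpace ℝ (Fin n)) (hx : ‖x‖ ≤ 1) : 0 ≤ FF e s p a x := by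
  unfold FF
  have : ‖x‖ ^ s ≤ 1 := Real.rpow_le_one (norm_nonneg _) hx hs.le
  exact div_nonneg (by linarith) (by positivity)

lemma dist_lb {n : ℕ} (e : EuclideanSpace ℝ (Fin n)) (he : ‖e‖ = 1)
    (x : EuclideanSpace ℝ (Fin n)) : 1 - ‖x‖ ≤ ‖e - x‖ := by
  have := norm_sub_norm_le e x
  linarith

lemma FF_dom {n : ℕ} (e : EuclideanSpace ℝ (Fin n)) (he : ‖e‖ = 1) (s p a : ℝ) (hs : 0 < s) 
    (x : EuclideanSpace ℝ (Fin n)) (hx : ‖x‖ < 1) : 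
    FF e s p a x * ‖e - x‖ ≤ (1 + s) * (2 ^ |-a| * ‖e - x‖ ^ (2 - p) + 2 ^ |2-p| * ‖x‖ ^ (-a)) := by
  have hlb := dist_lb e he x
  have hpos : 0 < ‖e - x‖ := by linarith
  have hub : ‖e - x‖ ≤ 2 := by
    have := norm_sub_le e x
    linarith
  have h1 := one_sub_le s ‖x‖ hs (norm_nonneg _) hx.le
  have h3 : 0 ≤ ‖x‖ ^ (-a) := by positivity
  have h4 : 0 ≤ ‖e - x‖ ^ (2-p) := by positivity
  have e1 : FF e s p a x * ‖e - x‖ = (1 - ‖x‖ ^ s) * ‖e-x‖ * (‖e-x‖ ^ (-p) * ‖x‖ ^ (-a)) := by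
    unfold FF
    rw [Real.rpow_neg hpos.le, Real.rpow_neg (norm_nonneg x), ← mul_inv, div_eq_mul_inv]; ring
  have e2 : ‖e-x‖ ^ (2-p) = ‖e-x‖ * ‖e-x‖ * ‖e-x‖^(-p) := by
    rw [show 2 - p = 2 + -p by ring, Real.rpow_add hpos, Real.rpow_two, sq]
  have key : FF e s p a x * ‖e - x‖ ≤ (1+s) * (‖e-x‖ ^ (2-p) * ‖x‖ ^ (-a)) := by
    rw [e1, e2]
    have h5 : 1 - ‖x‖ ^ s ≤ (1+s) * ‖e - x‖ := h1.trans (by gcongr)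
    calc _ ≤ ((1+s) * ‖e - x‖) * ‖e-x‖ * (‖e-x‖ ^ (-p) * ‖x‖ ^ (-a)) := by gcongr
      _ = _ := by ring
  refine key.trans ?_
  gcongr
  rcases le_total (1/2) ‖x‖ with h | h
  · have := rpow_bd ‖x‖ (-a) h (by linarith)
    have h6 : 0 ≤ (2:ℝ) ^ |2-p| * ‖x‖ ^ (-a) := by positivity
    nlinarith
  · have := rpow_bd ‖e-x‖ (2-p) (by linarith) hub
    have h6 : 0 ≤ (2:ℝ) ^ |-a| * ‖e-x‖ ^ (2-p) := by positivity
    nlinarith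

lemma FF_dom_int {n : ℕ} (hn : 2 ≤ n) (e : EuclideanSpace ℝ (Fin n)) (he : ‖e‖ = 1) (s p a : ℝ)
    (hs : 0 < s) (hp : p < n + 2) (ha : a < n) :
    IntegrableOn (fun x => FF e s p a x * ‖e - x‖) (Metric.ball 0 1) := by
  have i1 : IntegrableOn (fun x : EuclideanSpace ℝ (Fin n) => ‖x‖ ^ (-a)) (Metric.ball 0 1) :=
    norm_int hn _ _ one_pos (by linarith)
  have i2 : IntegrableOn (fun x : EuclideanSpace ℝ (Fin n) => ‖e - x‖ ^ (2 - p)) 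
      (Metric.ball 0 1) := by
    have h0 := norm_int hn (2-p) 2 two_pos (by linarith)
    rw [← integrable_indicator_iff Metric.isOpen_ball.measurableSet] at h0
    have h1 := h0.comp_sub_left e
    have h2 := h1.integrableOn (s := Metric.ball 0 1)
    refine h2.congr_fun (fun x hx => ?_) Metric.isOpen_ball.measurableSet
    simp only [mem_ball_zero_iff] at hx
    have := norm_sub_le e x
    show (Metric.ball 0 2).indicator _ (e - x) = _
    rw [Set.indicator_of_mem]
    simp only [mem_ball_zero_iff]; linarith
  have i3 := ((i2.const_mul (2 ^ |-a|)).add (i1.const_mul (2 ^ |2-p|))).const_mul (1+s)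
  refine i3.mono' (((FF_meas e s p a).mul (by fun_prop)).aestronglyMeasurable) ?_
  filter_upwards [ae_restrict_mem Metric.isOpen_ball.measurableSet] with x hx
  simp only [mem_ball_zero_iff] at hx
  have := FF_nonneg e s p a hs x hx.le
  rw [Real.norm_of_nonneg (by positivity)]
  exact FF_dom e he s p a hs x hx

lemma FF_int {n : ℕ} (hn : 2 ≤ n) (e : EuclideanSpace ℝ (Fin n)) (he : ‖e‖ = 1) (s p a : ℝ)
    (hs : 0 < s) (hp : p < n + 2) (ha : a < n) (r : ℝ) (hr : r < 1) :
    IntegrableOn (FF e s p a) (Metric.ball 0 r) := by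
  have i := ((FF_dom_int hn e he s p a hs hp ha).mono_set 
    (Metric.ball_subset_ball hr.le)).const_mul (1-r)⁻¹
  refine i.mono' (FF_meas e s p a).aestronglyMeasurable ?_
  filter_upwards [ae_restrict_mem Metric.isOpen_ball.measurableSet] with x hx
  simp only [mem_ball_zero_iff] at hx
  have h := FF_nonneg e s p a hs x (by linarith)
  rw [Real.norm_of_nonneg h]
  have hlb := dist_lb e he x
  have : 0 < 1 - r := by linarith
  rw [inv_mul_eq_div, le_div_iff₀ this]
  gcongr; linarith

lemma FF_small {n : ℕ} (hn : 2 ≤ n) (e : EuclideanSpace ℝ (Fin n)) (he : ‖e‖ = 1) (s p a : ℝ)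
    (hs : 0 < s) (hp : p < n + 2) (ha : a < n) :
    Tendsto (fun N : ℕ => (N:ℝ)⁻¹ * ∫ x in Metric.ball 0 (1 - 1/((N:ℝ)+2)), FF e s p a x)
      atTop (𝓝 0) := by
  have i := FF_dom_int hn e he s p a hs hp ha
  rw [← integrable_indicator_iff Metric.isOpen_ball.measurableSet] at i
  have T : Tendsto (fun N : ℕ => ∫ x, (((N:ℝ)+2)⁻¹ * 
      (Metric.ball 0 (1 - 1/((N:ℝ)+2))).indicator (FF e s p a) x)) atTop (𝓝 (∫ x : EuclideanSpace ℝ (Fin n), (0:ℝ))) := by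
    refine tendsto_integral_of_dominated_convergence _ (fun N => ?_) i (fun N => ?_) ?_
    · exact (((FF_meas e s p a).indicator Metric.isOpen_ball.measurableSet).const_mul _).aestronglyMeasurable
    · refine ae_of_all _ fun x => ?_
      have hN : (0:ℝ) < (N:ℝ) + 2 := by positivity
      by_cases hx : x ∈ Metric.ball (0 : EuclideanSpace ℝ (Fin n)) (1 - 1/((N:ℝ)+2))
      · have hx' : x ∈ Metric.ball (0 : EuclideanSpace ℝ (Fin n)) 1 :=
          Metric.ball_subset_ball (by have : 0 < 1/((N:ℝ)+2) := by positivity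
                                      linarith) hx
        rw [Set.indicator_of_mem hx, Set.indicator_of_mem hx']
        simp only [mem_ball_zero_iff] at hx hx'
        have h := FF_nonneg e s p a hs x (by linarith)
        rw [Real.norm_of_nonneg (by positivity), mul_comm]
        have hlb := dist_lb e he x
        gcongr
        rw [← one_div]; linarith
      · rw [Set.indicator_of_notMem hx]
        simp only [mul_zero, norm_zero]
        refine Set.indicator_nonneg (fun y hy => ?_) _
        simp only [mem_ball_zero_iff] at hy
        have h := FF_nonneg e s p a hs y hy.le
        positivity
    · refine ae_of_all _ fun x => ?_
      have t0 : Tendsto (fun N : ℕ => ((N:ℝ)+2)⁻¹) atTop (𝓝 0) :=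
        tendsto_inv_atTop_zero.comp (tendsto_atTop_add_const_right _ _ tendsto_natCast_atTop_atTop)
      have t1 : Tendsto (fun N : ℕ => ((N:ℝ)+2)⁻¹ * ‖FF e s p a x‖) atTop (𝓝 0) := by
        simpa using t0.mul_const ‖FF e s p a x‖
      refine squeeze_zero_norm (fun N => ?_) t1
      rw [norm_mul, Real.norm_of_nonneg (by positivity : (0:ℝ) ≤ ((N:ℝ)+2)⁻¹)]
      gcongr
      exact norm_indicator_le_norm_self _ _
  simp only [integral_zero] at T
  have T2 : Tendsto (fun N : ℕ => ((N:ℝ) + 2) / N) atTop (𝓝 1) := by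
    have : Tendsto (fun N : ℕ => 1 + 2 * (N:ℝ)⁻¹) atTop (𝓝 (1 + 2 * 0)) :=
      tendsto_const_nhds.add ((tendsto_inv_atTop_zero.comp tendsto_natCast_atTop_atTop).const_mul 2)
    simp only [mul_zero, add_zero] at this
    refine this.congr' ?_
    filter_upwards [eventually_gt_atTop 0] with N hN
    have : (N:ℝ) ≠ 0 := by positivity
    field_simp
  have T3 := T2.mul T
  rw [mul_zero] at T3
  refine T3.congr fun N => ?_
  rw [integral_const_mul, integral_indicator Metric.isOpen_ball.measurableSet]
  have : (N:ℝ) + 2 ≠ 0 := by positivity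
  rw [← mul_assoc, div_mul_eq_mul_div, mul_inv_cancel₀ this, one_div]

lemma seq_ge (A D I : ℕ → ℝ) (κ c : ℝ) (hI : ∀ k, I k = A k - D (k+1)) 
    (hAD : ∀ k, c ≤ A k - D k) (hD : Tendsto (fun N : ℕ => (N:ℝ)⁻¹ * D N) atTop (𝓝 0)) 
    (hκ : Tendsto I atTop (𝓝 κ)) : c ≤ κ := by
  have h1 := hκ.cesaro
  have h0 : Tendsto (fun N : ℕ => (N:ℝ)⁻¹) atTop (𝓝 0) :=
    tendsto_inv_atTop_zero.comp tendsto_natCast_atTop_atTop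
  have h2 : Tendsto (fun N : ℕ => c + (N:ℝ)⁻¹ * D 0 - (N:ℝ)⁻¹ * D N) atTop (𝓝 (c + 0 * D 0 - 0)) :=
    (tendsto_const_nhds.add (h0.mul_const _)).sub hD
  rw [zero_mul, add_zero, sub_zero] at h2
  refine le_of_tendsto_of_tendsto h2 h1 ?_
  filter_upwards [eventually_gt_atTop 0] with N hN
  have : (N:ℝ) * c + D 0 - D N ≤ ∑ i ∈ Finset.range N, I i := by
    clear hN
    induction N with
    | zero => simp
    | succ N ih => rw [Finset.sum_range_succ, hI]; push_cast; linarith [hAD N]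
  have hN' : (0:ℝ) < N := by positivity
  calc _ = (N:ℝ)⁻¹ * ((N:ℝ) * c + D 0 - D N) := by field_simp
    _ ≤ _ := by gcongr

lemma alg_id (n : ℕ) (s p a r d : ℝ) (hr : 0 < r) (hd : 0 ≤ d) :
    ((1/r)^2)^n * ((1-(1/r)^s)/((d/r)^p*(1/r)^a)) = -((1-r^s)/(d^p * r^(2*n+s-p-a))) := by
  have h1 : r^(2*n+s-p-a) = (r^2)^n * r^s / r^p / r^a := by
    rw [Real.rpow_sub hr, Real.rpow_sub hr, Real.rpow_add hr, ← pow_mul, ← Real.rpow_natCast]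
    push_cast; rfl
  have h2 := Real.rpow_pos_of_pos hr s
  have h3 := Real.rpow_pos_of_pos hr p
  have h4 := Real.rpow_pos_of_pos hr a
  rw [h1, Real.div_rpow hd hr.le, Real.div_rpow zero_le_one hr.le, Real.div_rpow zero_le_one hr.le]
  simp only [Real.one_rpow]
  rcases eq_or_ne (d^p) 0 with h | h
  · simp [h]
  · rw [one_div, inv_pow, inv_pow]
    field_simp
    ring

open EuclideanGeometry in
lemma outer {n : ℕ} (e : EuclideanSpace ℝ (Fin n)) (he : ‖e‖ = 1) (s p a ε : ℝ) (hε : 0 < ε)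
    (hi : IntegrableOn (FF e s p (2*n+s-p-a)) (Metric.ball 0 (1/(1+ε)))) :
    IntegrableOn (FF e s p a) {x | 1 + ε < ‖x‖} ∧
    ∫ x in {x | 1 + ε < ‖x‖}, FF e s p a x =
      - ∫ x in Metric.ball 0 (1/(1+ε)), FF e s p (2*n+s-p-a) x := by
  have hn0 : n ≠ 0 := by
    rintro rfl
    have : e = 0 := Subsingleton.elim _ _
    simp [this] at he
  have : Nonempty (Fin n) := ⟨⟨0, by omega⟩⟩
  have hnt : Nontrivial (EuclideanSpace ℝ (Fin n)) := inferInstance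
  set S : Set (EuclideanSpace ℝ (Fin n)) := Metric.ball 0 (1/(1+ε)) \ {0} with hS
  have hSm : MeasurableSet S := Metric.isOpen_ball.measurableSet.diff (measurableSet_singleton _)
  have hSae : S =ᵐ[volume] Metric.ball (0 : EuclideanSpace ℝ (Fin n)) (1/(1+ε)) :=
    sdiff_null_ae_eq_self (measure_singleton _)
  have hnorm : ∀ x : EuclideanSpace ℝ (Fin n), ‖inversion (0 : EuclideanSpace ℝ (Fin n)) 1 x‖ = 1 / ‖x‖ := by
    intro x
    have := dist_inversion_center (0 : EuclideanSpace ℝ (Fin n)) x 1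
    simpa using this
  have himg : inversion (0 : EuclideanSpace ℝ (Fin n)) 1 '' S = {x | 1 + ε < ‖x‖} := by
    rw [Function.Involutive.image_eq_preimage_symm (inversion_involutive (0 : EuclideanSpace ℝ (Fin n)) one_ne_zero)]
    ext x
    simp only [hS, Set.mem_preimage, Set.mem_sdiff, mem_ball_zero_iff, hnorm, Set.mem_singleton_iff,
      Set.mem_ofPred_eq, inversion_eq_center (one_ne_zero (α := ℝ))]
    constructor
    · rintro ⟨h, h0⟩
      have : 0 < ‖x‖ := norm_pos_iff.2 h0
      exact (one_div_lt_one_div this (by linarith)).1 h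
    · intro h
      refine ⟨(one_div_lt_one_div (by linarith) (by linarith)).2 h, ?_⟩
      rintro rfl
      simp at h; linarith
  have hder : ∀ x ∈ S, HasFDerivWithinAt (inversion (0 : EuclideanSpace ℝ (Fin n)) 1) 
      ((1 / dist x 0) ^ 2 • ((ℝ ∙ (x - 0))ᗮ.reflection : EuclideanSpace ℝ (Fin n) →L[ℝ] EuclideanSpace ℝ (Fin n))) S x :=
    fun x hx => (hasFDerivAt_inversion hx.2).hasFDerivWithinAt
  have hinj : Set.InjOn (inversion (0 : EuclideanSpace ℝ (Fin n)) 1) S :=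
    (inversion_injective _ one_ne_zero).injOn
  have hpt : ∀ x ∈ S, |((1 / dist x 0) ^ 2 • ((ℝ ∙ (x - 0))ᗮ.reflection : EuclideanSpace ℝ (Fin n) →L[ℝ] EuclideanSpace ℝ (Fin n))).det| •
      FF e s p a (inversion 0 1 x) = - FF e s p (2*n+s-p-a) x := by
    intro x hx
    have hx0 : x ≠ 0 := hx.2
    have hxp : 0 < ‖x‖ := norm_pos_iff.2 hx0
    have hdet : |((1 / dist x 0) ^ 2 • ((ℝ ∙ (x - 0))ᗮ.reflection : EuclideanSpace ℝ (Fin n) →L[ℝ] EuclideanSpace ℝ (Fin n))).det| = ((1/‖x‖)^2)^n := by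
      have hd : LinearMap.det (((ℝ ∙ (x - 0))ᗮ.reflection).toLinearMap) = _ := Submodule.det_reflection _
      have : ((1 / dist x 0) ^ 2 • ((ℝ ∙ (x - 0))ᗮ.reflection : EuclideanSpace ℝ (Fin n) →L[ℝ] EuclideanSpace ℝ (Fin n))).det = ((1 / dist x 0) ^ 2)^n * LinearMap.det (((ℝ ∙ (x - 0))ᗮ.reflection).toLinearMap) := by
        have := LinearMap.det_smul ((1 / dist x 0) ^ 2) (((ℝ ∙ (x - 0))ᗮ.reflection).toLinearMap)
        rw [finrank_euclideanSpace, Fintype.card_fin] at this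
        exact this
      rw [this, hd, abs_mul, abs_pow, abs_neg_one_pow, mul_one, abs_of_nonneg (by positivity), dist_zero_right]
    have he0 : e ≠ 0 := by rintro rfl; simp at he
    have hdist : ‖e - inversion 0 1 x‖ = ‖e - x‖ / ‖x‖ := by
      have h := dist_inversion_inversion he0 hx0 1
      have hee : inversion (0 : EuclideanSpace ℝ (Fin n)) 1 e = e :=
        inversion_of_mem_sphere (by simpa using he)
      rw [hee, dist_zero_right, dist_zero_right, he, dist_eq_norm, dist_eq_norm] at h
      rw [h]; ring
    rw [hdet, FF, FF, hdist, hnorm, smul_eq_mul]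
    exact alg_id n s p a ‖x‖ ‖e - x‖ hxp (norm_nonneg _)
  rw [← himg]
  constructor
  · rw [integrableOn_image_iff_integrableOn_abs_det_fderiv_smul volume hSm hder hinj]
    refine ((hi.mono_set Set.sdiff_subset).neg : IntegrableOn _ S _).congr_fun (fun x hx => (hpt x hx).symm) hSm
  · rw [integral_image_eq_integral_abs_det_fderiv_smul volume hSm hder hinj,
      setIntegral_congr_fun hSm hpt, integral_neg, setIntegral_congr_set hSae]

lemma split {n : ℕ} (hn : 2 ≤ n) (e : EuclideanSpace ℝ (Fin n)) (he : ‖e‖ = 1) (s p a : ℝ)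
    (hs : 0 < s) (hp : p < n + 2) (ha : a < n) (hb : 2*n+s-p-a < n) (ε : ℝ) (hε : 0 < ε) :
    ∫ x in {x : EuclideanSpace ℝ (Fin n) | ε < |‖x‖ - 1|}, FF e s p a x =
      (∫ x in Metric.ball 0 (1 - ε), FF e s p a x) -
      ∫ x in Metric.ball 0 (1/(1+ε)), FF e s p (2*n+s-p-a) x := by
  have hset : {x : EuclideanSpace ℝ (Fin n) | ε < |‖x‖ - 1|} = 
      Metric.ball 0 (1-ε) ∪ {x | 1 + ε < ‖x‖} := by
    ext x
    simp only [Set.mem_ofPred_eq, Set.mem_union, mem_ball_zero_iff, lt_abs]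
    constructor
    · rintro (h | h)
      · right; linarith
      · left; linarith
    · rintro (h | h)
      · right; linarith
      · left; linarith
  have hi := FF_int hn e he s p (2*n+s-p-a) hs hp hb (1/(1+ε)) (by
    rw [div_lt_one (by linarith)]; linarith)
  obtain ⟨h1, h2⟩ := outer e he s p a ε hε hi
  rw [hset, setIntegral_union ?_ ?_ (FF_int hn e he s p a hs hp ha _ (by linarith)) h1, h2]
  · ring
  · rw [Set.disjoint_left]
    intro x hx hx'
    simp only [Set.mem_ofPred_eq, mem_ball_zero_iff] at hx hx'
    linarith
  · exact measurableSet_lt measurable_const measurable_norm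

lemma FF_lt {n : ℕ} (e : EuclideanSpace ℝ (Fin n)) (he : ‖e‖ = 1) (s p a b : ℝ) (hs : 0 < s) 
    (hab : a < b) (x : EuclideanSpace ℝ (Fin n)) (hx : ‖x‖ < 1) (hx0 : x ≠ 0) :
    FF e s p a x < FF e s p b x := by
  unfold FF
  have hxp : 0 < ‖x‖ := norm_pos_iff.2 hx0
  have hlb := dist_lb e he x
  have hpos : 0 < ‖e - x‖ := by linarith
  have h1 : ‖x‖ ^ s < 1 := Real.rpow_lt_one (norm_nonneg _) hx hs
  have h2 : ‖x‖ ^ b < ‖x‖ ^ a := Real.rpow_lt_rpow_of_exponent_gt hxp hx hab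
  have h3 := Real.rpow_pos_of_pos hxp b
  have h4 := Real.rpow_pos_of_pos hpos p
  apply div_lt_div_of_pos_left (by linarith) (by positivity)
  gcongr

/-- difference gap -/
lemma gap {n : ℕ} (hn : 2 ≤ n) (e : EuclideanSpace ℝ (Fin n)) (he : ‖e‖ = 1) (s p a b : ℝ)
    (hs : 0 < s) (hp : p < n + 2) (ha : a < n) (hb : b < n) (hab : a < b) :
    ∃ c : ℝ, 0 < c ∧ ∀ r : ℝ, 1/2 ≤ r → r < 1 → 
      c ≤ (∫ x in Metric.ball 0 r, FF e s p b x) - ∫ x in Metric.ball 0 r, FF e s p a x := by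
  have : Nonempty (Fin n) := ⟨⟨0, by omega⟩⟩
  have hnt : Nontrivial (EuclideanSpace ℝ (Fin n)) := inferInstance
  have hi : ∀ r : ℝ, r < 1 → IntegrableOn (fun x => FF e s p b x - FF e s p a x) (Metric.ball 0 r) :=
    fun r hr => (FF_int hn e he s p b hs hp hb r hr).sub (FF_int hn e he s p a hs hp ha r hr)
  have hne : ∀ᵐ x : EuclideanSpace ℝ (Fin n), x ≠ 0 := by
    rw [ae_iff]; simp
  have hnn : ∀ r : ℝ, r < 1 → 0 ≤ᵐ[volume.restrict (Metric.ball 0 r)] (fun x => FF e s p b x - FF e s p a x) := by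
    intro r hr
    filter_upwards [ae_restrict_mem Metric.isOpen_ball.measurableSet, ae_restrict_of_ae hne] with x hx hx0
    simp only [mem_ball_zero_iff] at hx
    have := FF_lt e he s p a b hs hab x (by linarith) hx0
    simp only [Pi.zero_apply]; linarith
  refine ⟨∫ x in Metric.ball 0 (1/2), (FF e s p b x - FF e s p a x), ?_, fun r hr hr1 => ?_⟩
  · rw [setIntegral_pos_iff_support_of_nonneg_ae (hnn _ (by norm_num)) (hi _ (by norm_num))]
    have hpos : 0 < volume (Metric.ball (0 : EuclideanSpace ℝ (Fin n)) (1/2) \ {0}) := by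
      rw [measure_sdiff_null (measure_singleton _)]
      exact Metric.measure_ball_pos _ _ (by norm_num)
    refine hpos.trans_le (measure_mono ?_)
    rintro x ⟨hx, hx0⟩
    refine ⟨?_, hx⟩
    simp only [mem_ball_zero_iff] at hx
    have := FF_lt e he s p a b hs hab x (by linarith) hx0
    simp only [Function.mem_support]; linarith
  · rw [← integral_sub (FF_int hn e he s p b hs hp hb r hr1) (FF_int hn e he s p a hs hp ha r hr1)]
    exact setIntegral_mono_set (hi r hr1) (hnn r hr1) (Metric.ball_subset_ball hr).eventuallyLE

theorem stmt1 (n : ℕ) (γ α barα κ : ℝ) (hn : 2 ≤ n) (hγ : γ ∈ Set.Ioo (0:ℝ) 1)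
    (hbar : barα < 0) (h1 : -barα - α < 2*γ) (h2 : α < (n:ℝ))
    (hκ : Tendsto (fun ε : ℝ =>
        ∫ ζ in {ζ : EuclideanSpace ℝ (Fin n) | ε < |‖ζ‖ - 1|},
          (1 - ‖ζ‖ ^ (-barα)) /
            (‖EuclideanSpace.single (⟨0, by omega⟩ : Fin n) (1:ℝ) - ζ‖ ^ ((n:ℝ) + 2*γ)
              * ‖ζ‖ ^ α))
      (𝓝[>] 0) (𝓝 κ)) :
    (((n:ℝ) - 2*γ)/2 - barα/2 < α → 0 < κ) ∧
    (α < ((n:ℝ) - 2*γ)/2 - barα/2 → κ < 0) ∧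
    (α = ((n:ℝ) - 2*γ)/2 - barα/2 → κ = 0) := by
  obtain ⟨hγ0, hγ1⟩ := hγ
  set e : EuclideanSpace ℝ (Fin n) := EuclideanSpace.single (⟨0, by omega⟩ : Fin n) (1:ℝ) with hedef
  have he : ‖e‖ = 1 := by simp [hedef]
  set s := -barα with hsdef
  have hs : 0 < s := by linarith
  set p := (n:ℝ) + 2*γ with hpdef
  have hp : p < n + 2 := by linarith
  set β := 2*n+s-p-α with hβ
  have hb : β < n := by linarith
  let A : ℕ → ℝ := fun k => ∫ x in Metric.ball 0 (1 - 1/((k:ℝ)+2)), FF e s p α x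
  let D : ℕ → ℝ := fun k => ∫ x in Metric.ball 0 (1 - 1/((k:ℝ)+2)), FF e s p β x
  have hr : ∀ k : ℕ, 1/2 ≤ 1 - 1/((k:ℝ)+2) ∧ 1 - 1/((k:ℝ)+2) < 1 := by
    intro k
    have hk : (0:ℝ) ≤ k := by positivity
    have h3 : 1/((k:ℝ)+2) ≤ 1/2 := one_div_le_one_div_of_le (by norm_num) (by linarith)
    have h4 : 0 < 1/((k:ℝ)+2) := by positivity
    constructor <;> linarith
  have hA0 : Tendsto (fun N : ℕ => (N:ℝ)⁻¹ * A N) atTop (𝓝 0) := FF_small hn e he s p α hs hp h2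
  have hD0 : Tendsto (fun N : ℕ => (N:ℝ)⁻¹ * D N) atTop (𝓝 0) := FF_small hn e he s p β hs hp hb
  have hlim : Tendsto (fun k : ℕ => A k - D (k+1)) atTop (𝓝 κ) := by
    have t0 : Tendsto (fun k : ℕ => 1/((k:ℝ)+2)) atTop (𝓝[>] 0) := by
      rw [tendsto_nhdsWithin_iff]
      constructor
      · simp only [one_div]
        exact tendsto_inv_atTop_zero.comp (tendsto_atTop_add_const_right _ _ tendsto_natCast_atTop_atTop)
      · exact Eventually.of_forall fun k => by simp only [Set.mem_Ioi]; positivity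
    refine (hκ.comp t0).congr fun k => ?_
    have := split hn e he s p α hs hp h2 hb (1/((k:ℝ)+2)) (by positivity)
    refine this.trans ?_
    simp only [A, D]
    rw [show 1 / (1 + 1 / ((k:ℝ) + 2)) = 1 - 1 / (((k + 1 : ℕ) : ℝ) + 2) by
      push_cast; field_simp; ring]
  have hmono : ∀ k, D k ≤ D (k+1) := by
    intro k
    refine setIntegral_mono_set (FF_int hn e he s p β hs hp hb _ (hr (k+1)).2) ?_ ?_
    · filter_upwards [ae_restrict_mem Metric.isOpen_ball.measurableSet] with x hx
      simp only [mem_ball_zero_iff] at hx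
      exact FF_nonneg e s p β hs x (hx.le.trans (hr (k+1)).2.le)
    · refine (Metric.ball_subset_ball ?_).eventuallyLE
      push_cast
      have : 1/((k:ℝ)+1+2) ≤ 1/((k:ℝ)+2) := one_div_le_one_div_of_le (by positivity) (by linarith)
      linarith
  have hneg : ∀ k, A k ≤ D k → A k - D (k+1) ≤ 0 := fun k h => by linarith [hmono k]
  refine ⟨fun h => ?_, fun h => ?_, fun h => ?_⟩
  · obtain ⟨c, hc, hc'⟩ := gap hn e he s p β α hs hp hb h2 (by linarith)
    exact hc.trans_le (seq_ge A D _ κ c (fun _ => rfl) (fun k => hc' _ (hr k).1 (hr k).2) hD0 hlim)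
  · obtain ⟨c, hc, hc'⟩ := gap hn e he s p α β hs hp h2 hb (by linarith)
    have : κ ≤ -c := by
      refine le_of_tendsto hlim (Eventually.of_forall fun k => ?_)
      have h3 : c ≤ D k - A k := hc' _ (hr k).1 (hr k).2
      linarith [hmono k]
    linarith
  · have hab : β = α := by linarith
    have hAD : ∀ k, A k = D k := fun k => by simp only [A, D, hab]
    refine le_antisymm ?_ ?_
    · exact le_of_tendsto hlim (Eventually.of_forall fun k => hneg k (hAD k).le)
    · exact seq_ge A D _ κ 0 (fun _ => rfl) (fun k => by rw [hAD]; simp) hD0 hlim
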